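/- For every real s ≥ 6 there is a constant C such that for all t ≥ 0: ∫₀^{t/2} (t−σ) ⟨σ⟩³ ⟨σ⟩^{−(s−1)} ⟨t−σ⟩^{−s} dσ ≤ C ⟨t⟩^{−(s−1)}. -/

import Mathlib

open Real

noncomputable section

/-- The Japanese bracket `⟨x⟩ = (1+x²)^{1/2}`. -/
def jap (x : ℝ) : ℝ := Real.sqrt (1 + x ^ 2)

theorem one_le_jap (x : ℝ) : 1 ≤ jap x :=
  Real.one_le_sqrt.2 (by nlinarith [sq_nonneg x])

theorem jap_pos (x : ℝ) : 0 < jap x := zero_lt_one.trans_le (one_le_jap x)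

theorem le_jap (x : ℝ) : x ≤ jap x := Real.le_sqrt_of_sq_le (by linarith)

theorem jap_sq (x : ℝ) : jap x ^ 2 = 1 + x ^ 2 := Real.sq_sqrt (by positivity)

theorem continuous_jap : Continuous jap :=
  Real.continuous_sqrt.comp (by fun_prop)

theorem continuous_jap_rpow (p : ℝ) : Continuous fun x => jap x ^ p :=
  continuous_jap.rpow_const fun x => Or.inl (jap_pos x).ne'

theorem jap_div_two_le {t x : ℝ} (ht : 0 ≤ t) (hx : t / 2 ≤ x) : jap t / 2 ≤ jap x := by
  refine Real.le_sqrt_of_sq_le ?_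
  rw [div_pow, jap_sq]
  nlinarith

/-- The weight at the past time `σ` is dominated by the integrable function `⟨σ⟩⁻²`. -/
theorem jap_weight_le {s : ℝ} (hs : 6 ≤ s) (σ : ℝ) :
    jap σ ^ (3 : ℝ) * jap σ ^ (-(s - 1)) ≤ (1 + σ ^ 2)⁻¹ := by
  rw [← Real.rpow_add (jap_pos σ), ← jap_sq, ← Real.rpow_natCast, ← Real.rpow_neg (jap_pos σ).le]
  exact Real.rpow_le_rpow_of_exponent_le (one_le_jap σ) (by push_cast; linarith)

/-- At distance at least `t / 2`, one power of decay absorbs the linear growth. -/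
theorem mul_jap_rpow_le {s t x : ℝ} (hs : 1 ≤ s) (ht : 0 ≤ t) (hx : t / 2 ≤ x) :
    x * jap x ^ (-s) ≤ 2 ^ (s - 1) * jap t ^ (-(s - 1)) := by
  calc x * jap x ^ (-s) ≤ jap x * jap x ^ (-s) :=
        mul_le_mul_of_nonneg_right (le_jap x) (Real.rpow_nonneg (jap_pos x).le _)
    _ = jap x ^ (-(s - 1)) := by
        rw [show -(s - 1) = 1 + -s by ring, Real.rpow_add (jap_pos x), Real.rpow_one]
    _ ≤ (jap t / 2) ^ (-(s - 1)) :=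
        Real.rpow_le_rpow_of_nonpos (half_pos (jap_pos t)) (jap_div_two_le ht hx) (by linarith)
    _ = 2 ^ (s - 1) * jap t ^ (-(s - 1)) := by
        rw [Real.div_rpow (jap_pos t).le zero_le_two, Real.rpow_neg zero_le_two, div_inv_eq_mul,
          mul_comm]

/-- **Integral estimate (near-past part `I¹ₙ`).** For every real `s ≥ 6` there is a
constant `C` such that for all `t ≥ 0`:
`∫₀^{t/2} (t-σ) ⟨σ⟩³ ⟨σ⟩^{-(s-1)} ⟨t-σ⟩^{-s} dσ ≤ C ⟨t⟩^{-(s-1)}`. -/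
theorem near_past_integral_estimate (s : ℝ) (hs : 6 ≤ s) :
    ∃ C : ℝ, 0 < C ∧ ∀ t : ℝ, 0 ≤ t →
      (∫ σ in (0 : ℝ)..(t / 2),
          (t - σ) * jap σ ^ (3 : ℝ) * jap σ ^ (-(s - 1)) * jap (t - σ) ^ (-s)) ≤
        C * jap t ^ (-(s - 1)) := by
  refine ⟨π / 2 * 2 ^ (s - 1), by positivity, fun t ht => ?_⟩
  set K : ℝ := 2 ^ (s - 1) * jap t ^ (-(s - 1)) with hK
  have hK0 : 0 ≤ K := mul_nonneg (by positivity) (Real.rpow_nonneg (jap_pos t).le _)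
  have hcont : Continuous fun σ =>
      (t - σ) * jap σ ^ (3 : ℝ) * jap σ ^ (-(s - 1)) * jap (t - σ) ^ (-s) :=
    (((continuous_const.sub continuous_id).mul (continuous_jap_rpow _)).mul
      (continuous_jap_rpow _)).mul
      ((continuous_jap_rpow (-s)).comp (continuous_const.sub continuous_id))
  have hcont' : Continuous fun σ : ℝ => (1 + σ ^ 2)⁻¹ * K :=
    (Continuous.inv₀ (by fun_prop) fun σ => by positivity).mul continuous_const
  calc _ ≤ ∫ σ in (0 : ℝ)..(t / 2), (1 + σ ^ 2)⁻¹ * K := by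
        refine intervalIntegral.integral_mono_on (by linarith) (hcont.intervalIntegrable _ _)
          (hcont'.intervalIntegrable _ _) fun σ hσ => ?_
        have hx : t / 2 ≤ t - σ := by linarith [hσ.2]
        have hnonneg : 0 ≤ (t - σ) * jap (t - σ) ^ (-s) :=
          mul_nonneg (by linarith) (Real.rpow_nonneg (jap_pos _).le _)
        calc _ = jap σ ^ (3 : ℝ) * jap σ ^ (-(s - 1)) * ((t - σ) * jap (t - σ) ^ (-s)) := by ring
          _ ≤ _ := mul_le_mul (jap_weight_le hs σ) (mul_jap_rpow_le (by linarith) ht hx)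
            hnonneg (by positivity)
    _ = Real.arctan (t / 2) * K := by
        rw [intervalIntegral.integral_mul_const, integral_inv_one_add_sq, Real.arctan_zero,
          sub_zero]
    _ ≤ π / 2 * K := mul_le_mul_of_nonneg_right (Real.arctan_lt_pi_div_two _).le hK0
    _ = _ := by rw [hK, mul_assoc]
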